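/- arXiv:2503.16341 — 2 statements merged into one kernel-verified Lean document; each statement's English description precedes it below -/
import Mathlib

section
/- Let H and K be complex inner product spaces with dim(H) ≥ 2, and let A : H → K be a non-zero additive mapping preserving Euclidean orthogonality whose range A(H) is norm-dense in K. Then A is a positive scalar multiple of a complex-linear or of a conjugate-linear isometry; in particular A is complex-linear or conjugate-linear. -/
open scoped ComplexInnerProductSpace

section OrthogonalityPreserving

variable {H K : Type*} [NormedAddCommGroup H] [InnerProductSpace ℂ H]
  [NormedAddCommGroup K] [InnerProductSpace ℂ K]

open ComplexConjugate

lemma complex_inner_self (x : H) : ⟪x, x⟫ = ((‖x‖ ^ 2 : ℝ) : ℂ) := by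
  rw [inner_self_eq_norm_sq_to_K]; simp

/-- For a unit vector `u`, every vector is a combination of `u` and a unit vector orthogonal
to `u`. -/
lemma exists_orthogonal_unit_decomposition (hdim : 2 ≤ Module.rank ℂ H) {u : H} (hu : ‖u‖ = 1)
    (x : H) : ∃ (a b : ℂ) (f : H), ‖f‖ = 1 ∧ ⟪u, f⟫ = 0 ∧ x = a • u + b • f := by
  have huu : ⟪u, u⟫ = 1 := inner_self_eq_one_of_norm_eq_one hu
  have key : ∀ y : H, ⟪u, y - ⟪u, y⟫ • u⟫ = 0 := fun y => by
    rw [inner_sub_right, inner_smul_right, huu]; ring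
  have normalize : ∀ w : H, w ≠ 0 → ⟪u, w⟫ = 0 →
      ∃ f : H, ‖f‖ = 1 ∧ ⟪u, f⟫ = 0 ∧ w = (‖w‖ : ℂ) • f := fun w hw huw => by
    have hn : (‖w‖ : ℂ) ≠ 0 := by simpa using hw
    refine ⟨(‖w‖ : ℂ)⁻¹ • w, ?_, ?_, ?_⟩
    · rw [norm_smul, norm_inv, Complex.norm_real, norm_norm,
        inv_mul_cancel₀ (norm_ne_zero_iff.2 hw)]
    · rw [inner_smul_right, huw]; simp
    · rw [smul_smul, mul_inv_cancel₀ hn, one_smul]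
  by_cases hx : x - ⟪u, x⟫ • u = 0
  · obtain ⟨y, hy⟩ : ∃ y : H, y - ⟪u, y⟫ • u ≠ 0 := by
      by_contra! h
      have : Module.rank ℂ H ≤ 1 := rank_le_one_iff.2
        ⟨u, fun y => ⟨⟪u, y⟫, (sub_eq_zero.1 (h y)).symm⟩⟩
      exact absurd (hdim.trans this) (by norm_num)
    obtain ⟨f, hf, huf, -⟩ := normalize _ hy (key y)
    exact ⟨⟪u, x⟫, 0, f, hf, huf, by rw [zero_smul, add_zero]; exact sub_eq_zero.1 hx⟩
  · obtain ⟨f, hf, huf, h⟩ := normalize _ hx (key x)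
    exact ⟨⟪u, x⟫, _, f, hf, huf, by rw [← h]; abel⟩

/-- An additive orthogonality preserver compares its values along two orthogonal unit
directions. -/
lemma inner_map_smul_eq_of_orthogonal (A : H →+ K)
    (hop : ∀ x y : H, ⟪x, y⟫ = 0 → ⟪A x, A y⟫ = 0) {u v : H} (hu : ‖u‖ = 1) (hv : ‖v‖ = 1)
    (huv : ⟪u, v⟫ = 0) (a c : ℂ) :
    ⟪A (a • u), A (c • u)⟫ = ⟪A v, A ((conj a * c) • v)⟫ := by
  have huu : ⟪u, u⟫ = 1 := inner_self_eq_one_of_norm_eq_one hu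
  have hvv : ⟪v, v⟫ = 1 := inner_self_eq_one_of_norm_eq_one hv
  have hvu : ⟪v, u⟫ = 0 := inner_eq_zero_symm.1 huv
  have h := hop (a • u + v) (c • u - (conj a * c) • v) (by
    simp only [inner_add_left, inner_sub_right, inner_smul_left, inner_smul_right, huu, hvv,
      huv, hvu]
    ring)
  have h₁ : ⟪A (a • u), A ((conj a * c) • v)⟫ = 0 := hop _ _ (by
    rw [inner_smul_left, inner_smul_right, huv, mul_zero, mul_zero])
  have h₂ : ⟪A v, A (c • u)⟫ = 0 := hop _ _ (by rw [inner_smul_right, hvu, mul_zero])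
  rw [map_add, map_sub, inner_add_left, inner_sub_right, inner_sub_right, h₁, h₂] at h
  linear_combination h

/-- An additive orthogonality preserver transforms the inner product by an additive function. -/
lemma exists_inner_map_eq (hdim : 2 ≤ Module.rank ℂ H) (A : H →+ K)
    (hop : ∀ x y : H, ⟪x, y⟫ = 0 → ⟪A x, A y⟫ = 0) :
    ∃ Φ : ℂ →+ ℂ, ∀ x y : H, ⟪A x, A y⟫ = Φ ⟪x, y⟫ := by
  have : Nontrivial H := rank_pos_iff_nontrivial.1 (two_pos.trans_le hdim)
  obtain ⟨u, hu⟩ := exists_norm_eq H zero_le_one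
  obtain ⟨-, -, v, hv, huv, -⟩ := exists_orthogonal_unit_decomposition hdim hu 0
  have hΦ : ∀ a c : ℂ, ⟪A (a • u), A (c • u)⟫ = ⟪A u, A ((conj a * c) • u)⟫ := fun a c => by
    have h₁ := inner_map_smul_eq_of_orthogonal A hop hu hv huv
    have h₂ := h₁ 1 (conj a * c)
    rw [one_smul, map_one, one_mul] at h₂
    rw [h₁, h₂]
  refine ⟨⟨⟨fun z => ⟪A u, A (z • u)⟫, by simp⟩, fun z w => by
    simp only [add_smul, map_add, inner_add_right]⟩, fun x y => ?_⟩
  change _ = ⟪A u, A (⟪x, y⟫ • u)⟫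
  rcases eq_or_ne x 0 with rfl | hx
  · simp
  obtain ⟨a, b, f, hf, huf, hxf⟩ := exists_orthogonal_unit_decomposition hdim hu x
  have hfu : ⟪f, u⟫ = 0 := inner_eq_zero_symm.1 huf
  have huu : ⟪u, u⟫ = 1 := inner_self_eq_one_of_norm_eq_one hu
  have hff : ⟪f, f⟫ = 1 := inner_self_eq_one_of_norm_eq_one hf
  have hxx : ⟪x, x⟫ = conj a * a + conj b * b := by
    rw [hxf]
    simp only [inner_add_left, inner_add_right, inner_smul_left, inner_smul_right, huu, hff,
      huf, hfu]
    ring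
  have hx0 : ⟪x, x⟫ ≠ 0 := inner_self_ne_zero.2 hx
  set c := ⟪x, y⟫ / ⟪x, x⟫ with hc
  have hcx : ⟪x, y⟫ = c * ⟪x, x⟫ := by rw [hc, div_mul_cancel₀ _ hx0]
  have h₁ : ⟪A x, A y⟫ = ⟪A x, A (c • x)⟫ := by
    have h := hop x (y - c • x) (by rw [inner_sub_right, inner_smul_right, hcx, sub_self])
    rw [map_sub, inner_sub_right] at h
    exact sub_eq_zero.1 h
  have h₂ : ⟪A (a • u), A ((c * b) • f)⟫ = 0 := hop _ _ (by
    rw [inner_smul_left, inner_smul_right, huf, mul_zero, mul_zero])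
  have h₃ : ⟪A (b • f), A ((c * a) • u)⟫ = 0 := hop _ _ (by
    rw [inner_smul_left, inner_smul_right, hfu, mul_zero, mul_zero])
  have h₄ : ⟪x, y⟫ = conj a * (c * a) + conj b * (c * b) := by rw [hcx, hxx]; ring
  rw [h₁, h₄, hxf, smul_add, smul_smul, smul_smul, map_add, map_add, inner_add_left,
    inner_add_right, inner_add_right, h₂, h₃, hΦ,
    inner_map_smul_eq_of_orthogonal A hop hf hu hfu, add_smul, map_add, inner_add_right]
  ring

/-- An additive function on `ℝ` that is nonnegative on nonnegative numbers is linear. -/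
lemma AddMonoidHom.apply_eq_mul_of_nonneg (g : ℝ →+ ℝ) (hg : ∀ t, 0 ≤ t → 0 ≤ g t) (t : ℝ) :
    g t = t * g 1 := by
  have hmono : Monotone g := fun s t hst => by
    have := hg (t - s) (sub_nonneg.2 hst)
    rw [map_sub] at this
    linarith
  have h := map_real_smul g
    (MeasureTheory.Measure.AddMonoidHom.continuous_of_measurable g hmono.measurable) t 1
  simpa using h

/-- An additive orthogonality preserver is real-linear, and its effect on the inner product is
described by two real constants. -/
lemma exists_inner_map_eq_re_im (hdim : 2 ≤ Module.rank ℂ H) (A : H →+ K)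
    (hop : ∀ x y : H, ⟪x, y⟫ = 0 → ⟪A x, A y⟫ = 0) :
    (∀ (t : ℝ) (x : H), A (t • x) = t • A x) ∧
    ∃ γ β : ℝ, ∀ x y : H, ⟪A x, A y⟫ = ⟨γ * (⟪x, y⟫).re, β * (⟪x, y⟫).im⟩ := by
  obtain ⟨Φ, hΦ⟩ := exists_inner_map_eq hdim A hop
  have : Nontrivial H := rank_pos_iff_nontrivial.1 (two_pos.trans_le hdim)
  obtain ⟨e, he⟩ := exists_norm_eq H zero_le_one
  have hee : ⟪e, e⟫ = 1 := inner_self_eq_one_of_norm_eq_one he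
  have hΦe : ∀ z : ℂ, Φ z = ⟪A e, A (z • e)⟫ := fun z => by
    rw [hΦ, inner_smul_right, hee, mul_one]
  have hconj : ∀ z : ℂ, Φ (conj z) = conj (Φ z) := fun z => by
    rw [hΦe z, inner_conj_symm, hΦ, inner_smul_left, hee, mul_one]
  have hre : ∀ t : ℝ, Φ t = (t * (Φ 1).re : ℝ) := by
    have hpos : ∀ t : ℝ, 0 ≤ t → 0 ≤ (Φ t).re := fun t ht => by
      have h := hΦ ((√t : ℂ) • e) ((√t : ℂ) • e)
      rw [inner_smul_left, inner_smul_right, hee, mul_one, Complex.conj_ofReal,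
        ← Complex.ofReal_mul, Real.mul_self_sqrt ht] at h
      rw [← h]
      exact inner_self_nonneg (𝕜 := ℂ)
    intro t
    have h := AddMonoidHom.apply_eq_mul_of_nonneg
      (Complex.reAddGroupHom.comp (Φ.comp Complex.ofRealHom.toAddMonoidHom)) hpos t
    apply Complex.ext
    · simpa using h
    · have := hconj t
      rw [Complex.conj_ofReal] at this
      simpa using Complex.conj_eq_iff_im.1 this.symm
  set γ := (Φ 1).re
  have hnorm : ∀ x, ‖A x‖ ^ 2 = γ * ‖x‖ ^ 2 := fun x => by
    have h := hΦ x x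
    rw [complex_inner_self, complex_inner_self, hre, mul_comm] at h
    exact Complex.ofReal_injective h
  have hbound : ∀ x, ‖A x‖ ≤ √γ * ‖x‖ := fun x => by
    rw [← Real.sqrt_sq (norm_nonneg (A x)), hnorm, Real.sqrt_mul' _ (sq_nonneg _),
      Real.sqrt_sq (norm_nonneg x)]
  have hsmul : ∀ (t : ℝ) (x : H), A (t • x) = t • A x := fun t x =>
    map_real_smul A (AddMonoidHomClass.continuous_of_bound A _ hbound) t x
  refine ⟨hsmul, γ, (Φ Complex.I).im, fun x y => ?_⟩
  have him : (Φ Complex.I).re = 0 := by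
    have h := congrArg Complex.re (hconj Complex.I)
    rw [Complex.conj_I, map_neg, Complex.neg_re, Complex.conj_re] at h
    linarith
  have hI : ∀ t : ℝ, Φ (t * Complex.I) = t * Φ Complex.I := fun t => by
    rw [hΦe, hΦe, mul_smul, Complex.coe_smul, hsmul, ← Complex.coe_smul, inner_smul_right]
  rw [hΦ]
  conv_lhs => rw [← Complex.re_add_im ⟪x, y⟫]
  rw [map_add, hre, hI]
  apply Complex.ext <;> simp [him, mul_comm]

/-- An additive orthogonality preserver with dense range is a conformal map which commutes or
anticommutes with the complex structure. -/
lemma norm_map_and_map_I_smul_of_denseRange (hdim : 2 ≤ Module.rank ℂ H) (A : H →+ K)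
    (hop : ∀ x y : H, ⟪x, y⟫ = 0 → ⟪A x, A y⟫ = 0) (hdense : DenseRange A) (hA : ∃ x, A x ≠ 0) :
    ∃ γ : ℝ, 0 < γ ∧ (∀ x, ‖A x‖ = γ * ‖x‖) ∧
      ((∀ x, A (Complex.I • x) = Complex.I • A x) ∨
        (∀ x, A (Complex.I • x) = -(Complex.I • A x))) := by
  obtain ⟨-, γ, β, h⟩ := exists_inner_map_eq_re_im hdim A hop
  have hAA : ∀ x, ⟪A x, A x⟫ = ((γ * ‖x‖ ^ 2 : ℝ) : ℂ) := fun x => by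
    rw [h, complex_inner_self, Complex.ofReal_re, Complex.ofReal_im, mul_zero]; rfl
  have hnorm : ∀ x, ‖A x‖ ^ 2 = γ * ‖x‖ ^ 2 := fun x => by
    have h := hAA x
    rw [complex_inner_self] at h
    exact Complex.ofReal_injective h
  obtain ⟨x₀, hx₀⟩ := hA
  have hx₀' : 0 < ‖x₀‖ := norm_pos_iff.2 fun h => hx₀ (by rw [h, map_zero])
  have hγ : 0 < γ := by
    have h₁ : 0 < ‖A x₀‖ ^ 2 := by positivity
    rw [hnorm] at h₁
    exact pos_of_mul_pos_left h₁ (sq_nonneg _)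
  have hI : ∀ x, ⟪A (Complex.I • x), A x⟫ = ((-(β * ‖x‖ ^ 2) : ℝ) : ℂ) * Complex.I := fun x => by
    rw [h, inner_smul_left, complex_inner_self]; apply Complex.ext <;> simp [-Complex.ofReal_pow]
  have hβ : γ ^ 2 = β ^ 2 := by
    have hzero : (fun k : K => γ * (⟪A x₀, k⟫).im - β * (⟪A (Complex.I • x₀), k⟫).re) =
        fun _ => 0 := by
      refine hdense.equalizer (by fun_prop) continuous_const (funext fun y => ?_)
      simp only [Function.comp_apply, h, inner_smul_left]
      simp
      ring
    have h₁ := congrFun hzero (Complex.I • A x₀)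
    simp only [inner_smul_right, hAA, hI] at h₁
    simp [-Complex.ofReal_pow] at h₁
    have h₂ : (γ ^ 2 - β ^ 2) * ‖x₀‖ ^ 2 = 0 := by linear_combination h₁
    rcases mul_eq_zero.1 h₂ with h₃ | h₃
    · linarith
    · exact absurd h₃ (by positivity)
  have hdist : ∀ (s : ℝ) (x : H), s ^ 2 = 1 →
      ‖A (Complex.I • x) - (s * Complex.I) • A x‖ ^ 2 = 2 * (γ - s * β) * ‖x‖ ^ 2 :=
    fun s x hs => by
      have hs' : ‖(s * Complex.I : ℂ)‖ ^ 2 = 1 := by simpa using hs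
      rw [norm_sub_sq (𝕜 := ℂ), norm_smul, mul_pow, hs', hnorm, hnorm, norm_smul,
        inner_smul_right, hI]
      simp [-Complex.ofReal_pow]
      ring
  refine ⟨√γ, Real.sqrt_pos.2 hγ, fun x => ?_, ?_⟩
  · rw [← Real.sqrt_sq (norm_nonneg (A x)), hnorm, Real.sqrt_mul' _ (sq_nonneg _),
      Real.sqrt_sq (norm_nonneg x)]
  · rcases sq_eq_sq_iff_eq_or_eq_neg.1 hβ with hs | hs
    · refine Or.inl fun x => ?_
      have h₁ := hdist 1 x (by norm_num)
      rw [hs] at h₁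
      simpa [sub_eq_zero] using h₁
    · refine Or.inr fun x => ?_
      have h₁ := hdist (-1) x (by norm_num)
      rw [hs] at h₁
      simpa [add_eq_zero_iff_eq_neg] using h₁

/-- A real-homogeneous additive map commuting with multiplication by `I` up to conjugation is
complex-linear or conjugate-linear. -/
lemma map_smul_or_map_smul_conj (A : H →+ K) (hreal : ∀ (t : ℝ) (x : H), A (t • x) = t • A x)
    (hI : (∀ x, A (Complex.I • x) = Complex.I • A x) ∨
      (∀ x, A (Complex.I • x) = -(Complex.I • A x))) :
    (∀ (l : ℂ) (x : H), A (l • x) = l • A x) ∨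
      (∀ (l : ℂ) (x : H), A (l • x) = (starRingEnd ℂ l) • A x) := by
  have hdecomp : ∀ (l : ℂ) (x : H), A (l • x) = l.re • A x + l.im • A (Complex.I • x) :=
    fun l x => by
      conv_lhs => rw [← Complex.re_add_im l]
      rw [add_smul, mul_smul, Complex.coe_smul, Complex.coe_smul, map_add, hreal, hreal]
  refine hI.imp (fun hI l x => ?_) (fun hI l x => ?_)
  · rw [hdecomp, hI]
    conv_rhs => rw [← Complex.re_add_im l]
    rw [add_smul, mul_smul, Complex.coe_smul, Complex.coe_smul]
  · rw [hdecomp, hI]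
    conv_rhs => rw [← Complex.re_add_im l]
    rw [map_add, map_mul, Complex.conj_ofReal, Complex.conj_ofReal, Complex.conj_I, add_smul,
      mul_smul, Complex.coe_smul, Complex.coe_smul, neg_smul]

end OrthogonalityPreserving

/-- A non-zero additive orthogonality preserving map with norm-dense range between
complex inner product spaces (`dim H ≥ 2`) is a positive scalar multiple of a
complex-linear or conjugate-linear isometry; in particular it is complex-linear or
conjugate-linear. -/
theorem denseRange_additive_op_is_scalar_multiple_of_isometry
    {H K : Type*} [NormedAddCommGroup H] [InnerProductSpace ℂ H]
    [NormedAddCommGroup K] [InnerProductSpace ℂ K]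
    (hdim : 2 ≤ Module.rank ℂ H)
    (A : H → K) (hA : A ≠ 0)
    (hadd : ∀ x y, A (x + y) = A x + A y)
    (hop : ∀ x y : H, ⟪x, y⟫ = 0 → ⟪A x, A y⟫ = 0)
    (hdense : DenseRange A) :
    (∃ (γ : ℝ) (T : H → K), 0 < γ ∧
      (∀ x y, T (x + y) = T x + T y) ∧ (∀ x, ‖T x‖ = ‖x‖) ∧
      ((∀ (l : ℂ) (x : H), T (l • x) = l • T x) ∨
        (∀ (l : ℂ) (x : H), T (l • x) = (starRingEnd ℂ l) • T x)) ∧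
      (∀ x, A x = γ • T x)) ∧
    ((∀ (l : ℂ) (x : H), A (l • x) = l • A x) ∨
      (∀ (l : ℂ) (x : H), A (l • x) = (starRingEnd ℂ l) • A x)) := by
  have hne : ∃ x, A x ≠ 0 := Function.ne_iff.1 hA
  let B : H →+ K := AddMonoidHom.mk' A hadd
  obtain ⟨γ, hγ, hnorm, hI⟩ := norm_map_and_map_I_smul_of_denseRange hdim B hop hdense hne
  have hreal := (exists_inner_map_eq_re_im hdim B hop).1
  have hlin : (∀ (l : ℂ) (x : H), A (l • x) = l • A x) ∨
      (∀ (l : ℂ) (x : H), A (l • x) = (starRingEnd ℂ l) • A x) :=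
    map_smul_or_map_smul_conj B hreal hI
  refine ⟨⟨γ, fun x => γ⁻¹ • A x, hγ, fun x y => ?_, fun x => ?_, ?_, fun x => ?_⟩, hlin⟩
  · simp only [hadd, smul_add]
  · have h : ‖A x‖ = γ * ‖x‖ := hnorm x
    rw [norm_smul, norm_inv, Real.norm_of_nonneg hγ.le, h, inv_mul_cancel_left₀ hγ.ne']
  · refine hlin.imp (fun h l x => ?_) (fun h l x => ?_)
    · simp only [h, smul_comm γ⁻¹]
    · simp only [h, smul_comm γ⁻¹]
  · simp only [smul_smul, mul_inv_cancel₀ hγ.ne', one_smul]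
end

section
/- Let A : H → K be an additive orthogonality preserving mapping between two complex inner product spaces with dim(H) ≥ 2. Then A is real-linear and continuous, and there exists a unique continuous real-linear map à : H̃ → K̃ between the completions H̃ of H and K̃ of K which extends A (via the canonical embeddings) and preserves Euclidean orthogonality. -/
open scoped ComplexInnerProductSpace
open UniformSpace

/-- An additive function on the reals that is nonnegative on nonnegative numbers is linear. -/
theorem AddMonoidHom.apply_eq_mul_of_nonneg_s15 (φ : ℝ →+ ℝ) (hφ : ∀ t, 0 ≤ t → 0 ≤ φ t) (t : ℝ) :
    φ t = t * φ 1 := by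
  have hmono : Monotone φ := fun a b hab => by
    have := hφ (b - a) (sub_nonneg.2 hab)
    rw [map_sub] at this
    linarith
  have hcont : Continuous φ := MeasureTheory.Measure.AddMonoidHom.continuous_of_measurable φ hmono.measurable
  simpa using map_real_smul φ hcont t 1

section OrthogonalityPreserving

variable {H K : Type*} [NormedAddCommGroup H] [InnerProductSpace ℂ H]
  [NormedAddCommGroup K] [InnerProductSpace ℂ K]

/-- In dimension at least two, every vector is orthogonal to a nonzero vector. -/
theorem exists_ne_zero_inner_eq_zero (hdim : 2 ≤ Module.rank ℂ H) (x : H) :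
    ∃ y : H, y ≠ 0 ∧ ⟪x, y⟫ = 0 := by
  have hne : (Submodule.span ℂ {x})ᗮ ≠ ⊥ := by
    intro h
    rw [Submodule.orthogonal_eq_bot_iff] at h
    have h1 := rank_span_le (R := ℂ) ({x} : Set H)
    rw [h, rank_top, Cardinal.mk_singleton] at h1
    exact absurd (hdim.trans h1) (by norm_num)
  obtain ⟨y, hy, hy0⟩ := Submodule.exists_mem_ne_zero_of_ne_bot hne
  exact ⟨y, hy0, Submodule.mem_orthogonal_singleton_iff_inner_right.1 hy⟩

/-- In dimension at least two, every vector is orthogonal to a vector of the same norm. -/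
theorem exists_norm_eq_inner_eq_zero (hdim : 2 ≤ Module.rank ℂ H) (x : H) :
    ∃ y : H, ‖x‖ = ‖y‖ ∧ ⟪x, y⟫ = 0 := by
  obtain ⟨y, hy0, hy⟩ := exists_ne_zero_inner_eq_zero hdim x
  have : ‖y‖ ≠ 0 := norm_ne_zero_iff.2 hy0
  refine ⟨((‖x‖ / ‖y‖ : ℝ) : ℂ) • y, ?_, by rw [inner_smul_right, hy, mul_zero]⟩
  rw [norm_smul, Complex.norm_real, norm_div, norm_norm, norm_norm, div_mul_cancel₀ _ this]

theorem inner_real_smul_add_real_smul_sub {x y : H} (hn : ‖x‖ = ‖y‖) (hxy : ⟪x, y⟫ = 0)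
    {a b c d : ℝ} (h : a * c = b * d) : ⟪a • x + b • y, c • x - d • y⟫ = 0 := by
  have hyx : ⟪y, x⟫ = 0 := inner_eq_zero_symm.1 hxy
  have h' : (a : ℂ) * c = b * d := by exact_mod_cast h
  simp only [← Complex.coe_smul, inner_add_left, inner_sub_right, inner_smul_left,
    inner_smul_right, hxy, hyx, Complex.conj_ofReal, inner_self_eq_norm_sq_to_K, hn]
  linear_combination ((‖y‖ : ℂ) ^ 2) * h'

variable {A : H →+ K} (hop : ∀ x y : H, ⟪x, y⟫ = 0 → ⟪A x, A y⟫ = 0)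
  {x y : H} (hn : ‖x‖ = ‖y‖) (hxy : ⟪x, y⟫ = 0)

include hop hn hxy

theorem inner_map_smul_eq_of_mul_eq {a b c d : ℝ} (h : a * c = b * d) :
    ⟪A (a • x), A (c • x)⟫ = ⟪A (b • y), A (d • y)⟫ := by
  have h1 := hop _ _ (inner_real_smul_add_real_smul_sub hn hxy h)
  have h2 : ⟪A (a • x), A (d • y)⟫ = 0 := hop _ _ (by
    simp [← Complex.coe_smul, hxy])
  have h3 : ⟪A (b • y), A (c • x)⟫ = 0 := hop _ _ (by
    simp [← Complex.coe_smul, inner_eq_zero_symm.1 hxy])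
  rw [map_add, map_sub, inner_add_left, inner_sub_right, inner_sub_right, h2, h3] at h1
  linear_combination h1

theorem norm_map_eq_of_inner_eq_zero : ‖A x‖ = ‖A y‖ := by
  have h := inner_map_smul_eq_of_mul_eq hop hn hxy (a := 1) (b := 1) (c := 1) (d := 1) rfl
  simp only [one_smul, inner_self_eq_norm_sq_to_K] at h
  have h' : ‖A x‖ ^ 2 = ‖A y‖ ^ 2 := by exact_mod_cast h
  exact (sq_eq_sq₀ (norm_nonneg _) (norm_nonneg _)).1 h'

theorem map_real_smul_of_inner_eq_zero (r : ℝ) : A (r • x) = r • A x := by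
  have key : ∀ s t : ℝ, ⟪A (s • x), A (t • x)⟫ = ⟪A ((1 : ℝ) • x), A ((s * t) • x)⟫ := by
    intro s t
    rw [inner_map_smul_eq_of_mul_eq hop hn hxy (a := s) (c := t) (b := 1) (d := s * t) (by ring),
      inner_map_smul_eq_of_mul_eq hop hn hxy (a := 1) (c := s * t) (b := 1) (d := s * t) rfl]
  let φ : ℝ →+ ℝ :=
    { toFun := fun t => (⟪A ((1 : ℝ) • x), A (t • x)⟫).re
      map_zero' := by simp
      map_add' := fun s t => by rw [add_smul, map_add, inner_add_right, Complex.add_re] }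
  have hφ : ∀ s t : ℝ, (⟪A (s • x), A (t • x)⟫).re = φ (s * t) := fun s t => by
    rw [key]; rfl
  have hsq : ∀ t : ℝ, ‖A (t • x)‖ ^ 2 = φ (t * t) := fun t => by
    rw [← hφ, inner_self_eq_norm_sq_to_K]
    norm_cast
  have hlin : ∀ t, φ t = t * φ 1 := φ.apply_eq_mul_of_nonneg_s15 fun t ht => by
    rw [← Real.mul_self_sqrt ht, ← hsq]
    positivity
  have h1 : ‖A x‖ ^ 2 = φ 1 := by simpa using hsq 1
  have h2 : (⟪A (r • x), A x⟫).re = φ r := by simpa using hφ r 1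
  have h3 : ‖A (r • x) - r • A x‖ ^ 2 = 0 := by
    rw [@norm_sub_sq ℂ, ← Complex.coe_smul r (A x), inner_smul_right, norm_smul, mul_pow, h1, hsq,
      RCLike.re_to_complex, Complex.re_ofReal_mul, h2, Complex.norm_real, Real.norm_eq_abs, sq_abs,
      hlin (r * r), hlin r]
    ring
  exact sub_eq_zero.1 (norm_eq_zero.1 (pow_eq_zero_iff two_ne_zero |>.1 h3))

omit hn hxy

/-- An additive orthogonality preserving map is real-homogeneous. -/
theorem map_real_smul_of_orthogonality_preserving (hdim : 2 ≤ Module.rank ℂ H) (r : ℝ) (x : H) :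
    A (r • x) = r • A x := by
  obtain ⟨y, hn, hxy⟩ := exists_norm_eq_inner_eq_zero hdim x
  exact map_real_smul_of_inner_eq_zero hop hn hxy r

/-- An additive orthogonality preserving map scales the norms of orthogonal vectors alike. -/
theorem norm_mul_norm_map_of_inner_eq_zero (hdim : 2 ≤ Module.rank ℂ H) {x y : H}
    (hxy : ⟪x, y⟫ = 0) : ‖y‖ * ‖A x‖ = ‖x‖ * ‖A y‖ := by
  have h := norm_map_eq_of_inner_eq_zero hop (x := ‖y‖ • x) (y := ‖x‖ • y)
    (by simp [norm_smul, mul_comm])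
    (by simp [← Complex.coe_smul, hxy])
  simpa [map_real_smul_of_orthogonality_preserving hop hdim, norm_smul] using h

/-- An additive orthogonality preserving map is a multiple of an isometry. -/
theorem exists_norm_map_eq_mul_norm (hdim : 2 ≤ Module.rank ℂ H) :
    ∃ C : ℝ, 0 ≤ C ∧ ∀ u, ‖A u‖ = C * ‖u‖ := by
  obtain ⟨v, hv0, -⟩ := exists_ne_zero_inner_eq_zero hdim (0 : H)
  obtain ⟨w, hn, hvw⟩ := exists_norm_eq_inner_eq_zero hdim v
  have hv : ‖v‖ ≠ 0 := norm_ne_zero_iff.2 hv0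
  have hw : ‖w‖ ≠ 0 := hn ▸ hv
  have hAvw : ‖A v‖ = ‖A w‖ := norm_map_eq_of_inner_eq_zero hop hn hvw
  refine ⟨‖A v‖ / ‖v‖, by positivity, fun u => ?_⟩
  obtain ⟨p, hp, q, hq, rfl⟩ := (Submodule.span ℂ {v}).exists_add_mem_mem_orthogonal u
  obtain ⟨a, rfl⟩ := Submodule.mem_span_singleton.1 hp
  have hvq : ⟪v, q⟫ = 0 := Submodule.mem_orthogonal_singleton_iff_inner_right.1 hq
  have hpq : ⟪a • v, q⟫ = 0 := by rw [inner_smul_left, hvq, mul_zero]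
  have hpw : ⟪a • v, w⟫ = 0 := by rw [inner_smul_left, hvw, mul_zero]
  have h1 : ‖A (a • v)‖ = ‖A v‖ / ‖v‖ * ‖a • v‖ := by
    have := norm_mul_norm_map_of_inner_eq_zero hop hdim hpw
    rw [hAvw, hn]
    field_simp
    linarith
  have h2 : ‖A q‖ = ‖A v‖ / ‖v‖ * ‖q‖ := by
    have := norm_mul_norm_map_of_inner_eq_zero hop hdim hvq
    field_simp
    linarith
  have h3 := norm_add_sq_eq_norm_sq_add_norm_sq_of_inner_eq_zero _ _ hpq
  have h4 := norm_add_sq_eq_norm_sq_add_norm_sq_of_inner_eq_zero _ _ (hop _ _ hpq)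
  rw [← map_add, h1, h2] at h4
  refine (mul_self_inj (norm_nonneg _) (by positivity)).1 ?_
  rw [h4]
  linear_combination -(‖A v‖ / ‖v‖) ^ 2 * h3

/-- An additive orthogonality preserving map distorts inner products by a bounded factor. -/
theorem norm_inner_map_map_le {C : ℝ} (hC : ∀ u, ‖A u‖ = C * ‖u‖) (x y : H) :
    ‖⟪A x, A y⟫‖ ≤ C ^ 2 * ‖⟪x, y⟫‖ := by
  obtain ⟨p, hp, q, hq, rfl⟩ := (Submodule.span ℂ {x}).exists_add_mem_mem_orthogonal y
  obtain ⟨a, rfl⟩ := Submodule.mem_span_singleton.1 hp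
  have hxq : ⟪x, q⟫ = 0 := Submodule.mem_orthogonal_singleton_iff_inner_right.1 hq
  rw [map_add, inner_add_right, inner_add_right, hop _ _ hxq, hxq, add_zero, add_zero]
  refine (norm_inner_le_norm _ _).trans_eq ?_
  rw [hC, hC, inner_smul_right, inner_self_eq_norm_sq_to_K, norm_smul, norm_mul, norm_pow,
    RCLike.norm_ofReal, abs_norm]
  ring

end OrthogonalityPreserving

/-- Every additive orthogonality preserving map between complex inner product
spaces (`dim H ≥ 2`) is real-linear and continuous and extends uniquely to a
continuous real-linear orthogonality preserving map between the completions. -/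
theorem additive_op_extends_to_completion
    {H K : Type*} [NormedAddCommGroup H] [InnerProductSpace ℂ H]
    [NormedAddCommGroup K] [InnerProductSpace ℂ K]
    (hdim : 2 ≤ Module.rank ℂ H)
    (A : H → K)
    (hadd : ∀ x y, A (x + y) = A x + A y)
    (hop : ∀ x y : H, ⟪x, y⟫ = 0 → ⟪A x, A y⟫ = 0) :
    (∀ (r : ℝ) (x : H), A (r • x) = r • A x) ∧ Continuous A ∧
    ∃! Atilde : Completion H →L[ℝ] Completion K,
      (∀ x : H, Atilde (x : Completion H) = (A x : Completion K)) ∧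
      (∀ z w : Completion H, ⟪z, w⟫ = 0 → ⟪Atilde z, Atilde w⟫ = 0) := by
  let A₀ : H →+ K := AddMonoidHom.mk' A hadd
  have hop₀ : ∀ x y : H, ⟪x, y⟫ = 0 → ⟪A₀ x, A₀ y⟫ = 0 := hop
  have hsmul : ∀ (r : ℝ) (x : H), A (r • x) = r • A x :=
    map_real_smul_of_orthogonality_preserving hop₀ hdim
  obtain ⟨C, hC0, hC⟩ := exists_norm_map_eq_mul_norm hop₀ hdim
  let L : H →L[ℝ] K :=
    LinearMap.mkContinuous { toFun := A, map_add' := hadd, map_smul' := hsmul } C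
      fun x => (hC x).le
  refine ⟨hsmul, L.continuous, ?_⟩
  have hcoe : ∀ x : H, L.completion (x : Completion H) = (A x : Completion K) :=
    fun x => L.completion_apply_coe x
  refine ⟨L.completion, ⟨hcoe, ?_⟩, ?_⟩
  · have hle : ∀ z w : Completion H,
        ‖⟪L.completion z, L.completion w⟫‖ ≤ C ^ 2 * ‖⟪z, w⟫‖ := by
      intro z w
      refine Completion.induction_on₂ z w ?_ fun x y => ?_
      · exact isClosed_le (by fun_prop) (by fun_prop)
      · rw [hcoe, hcoe, Completion.inner_coe, Completion.inner_coe]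
        exact norm_inner_map_map_le hop₀ hC x y
    intro z w hzw
    simpa [hzw] using hle z w
  · rintro T ⟨hT, -⟩
    ext z
    refine Completion.induction_on z (isClosed_eq T.continuous L.completion.continuous) fun x => ?_
    rw [hT, hcoe]
end
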